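/- Let i ∈ [n] and j ∈ [2,n] (i.e., 2 ≤ j ≤ n) be such that i ≤ j. Then [t_i, t_j] · t_{j−1} = 0 in k[S_n]. -/

import Mathlib

/-- The simple transposition `s_i ∈ S_n` (1-based indexing), swapping `i` and `i+1`,
defined as the identity for `i` outside `{1, …, n-1}`. -/
def simpleTransposition (n i : ℕ) : Equiv.Perm (Fin n) :=
  if h : 1 ≤ i ∧ i < n then
    Equiv.swap ⟨i - 1, by omega⟩ ⟨i, h.2⟩
  else 1

/-- The cycle `(v ⟹ w) = s_v s_{v+1} ⋯ s_{w-1} ∈ S_n`, sending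
`v ↦ v+1 ↦ ⋯ ↦ w ↦ v` (and equal to the identity when `v = w`). -/
def cyc (n v w : ℕ) : Equiv.Perm (Fin n) :=
  ((List.range' v (w - v)).map (simpleTransposition n)).prod

/-- The somewhere-to-below shuffle `t_ℓ = Σ_{w=ℓ}^{n} (ℓ ⟹ w)` in the group
algebra `R[S_n]`. -/
noncomputable def t (R : Type*) [CommRing R] (n ℓ : ℕ) :
    MonoidAlgebra R (Equiv.Perm (Fin n)) :=
  ∑ w ∈ Finset.Icc ℓ n, MonoidAlgebra.of R (Equiv.Perm (Fin n)) (cyc n ℓ w)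

theorem simpleTransposition_mul_self (n i : ℕ) :
    simpleTransposition n i * simpleTransposition n i = 1 := by
  unfold simpleTransposition
  split_ifs <;> simp

theorem commute_simpleTransposition (n : ℕ) {i j : ℕ} (h : i + 1 < j) :
    Commute (simpleTransposition n i) (simpleTransposition n j) := by
  unfold simpleTransposition
  split_ifs with hi hj
  · apply Equiv.Perm.Disjoint.commute
    rw [Equiv.Perm.disjoint_iff_disjoint_support, Equiv.Perm.support_swap (by simp; omega),
      Equiv.Perm.support_swap (by simp; omega)]
    simp only [Finset.disjoint_insert_left, Finset.disjoint_singleton_left, Finset.mem_insert,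
      Finset.mem_singleton, Fin.mk.injEq]
    omega
  all_goals simp

theorem simpleTransposition_braid (n : ℕ) {i : ℕ} (hi : 1 ≤ i) (hn : i + 1 < n) :
    simpleTransposition n i * simpleTransposition n (i + 1) * simpleTransposition n i =
      simpleTransposition n (i + 1) * simpleTransposition n i * simpleTransposition n (i + 1) := by
  unfold simpleTransposition
  rw [dif_pos ⟨hi, by omega⟩, dif_pos ⟨by omega, hn⟩]
  simp only [Nat.add_sub_cancel]
  rw [Equiv.swap_comm (⟨i - 1, by omega⟩ : Fin n) ⟨i, by omega⟩,
    Equiv.swap_comm (⟨i, by omega⟩ : Fin n) ⟨i + 1, by omega⟩,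
    Equiv.swap_mul_swap_mul_swap (by simp) (by simp; omega),
    Equiv.swap_comm (⟨i, by omega⟩ : Fin n) ⟨i - 1, by omega⟩,
    Equiv.swap_comm (⟨i + 1, by omega⟩ : Fin n) ⟨i, by omega⟩,
    Equiv.swap_mul_swap_mul_swap (by simp; omega) (by simp), Equiv.swap_comm]

theorem cyc_self (n v : ℕ) : cyc n v v = 1 := by
  simp [cyc]

theorem cyc_succ (n v : ℕ) : cyc n v (v + 1) = simpleTransposition n v := by
  simp [cyc]

theorem cyc_mul_cyc (n : ℕ) {u v w : ℕ} (huv : u ≤ v) (hvw : v ≤ w) :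
    cyc n u v * cyc n v w = cyc n u w := by
  obtain ⟨a, rfl⟩ := Nat.exists_eq_add_of_le huv
  obtain ⟨b, rfl⟩ := Nat.exists_eq_add_of_le hvw
  have hb : u + a + b - u = a + b := by omega
  simp only [cyc, hb, Nat.add_sub_cancel_left, ← List.prod_append, ← List.map_append,
    List.range'_append_1]

theorem commute_cyc (n : ℕ) {u v w x : ℕ} (h : v < w) :
    Commute (cyc n u v) (cyc n w x) := by
  refine Commute.list_prod_left _ _ fun a ha => Commute.list_prod_right _ _ fun b hb => ?_
  simp only [List.mem_map, List.mem_range'_1] at ha hb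
  obtain ⟨k, hk, rfl⟩ := ha
  obtain ⟨l, hl, rfl⟩ := hb
  exact commute_simpleTransposition n (by omega)

theorem mul_one_add_mul_eq_of_braid {A : Type*} [Ring A] {s u c : A} (hs : s * s = 1)
    (hb : s * u * s = u * s * u) (hc : s * c = c * s)
    (hu : u * (c * (1 + u * c)) = c * (1 + u * c)) :
    s * ((1 + u * c) * (1 + s * (1 + u * c))) = (1 + u * c) * (1 + s * (1 + u * c)) := by
  set x := c * (1 + u * c) with hx
  have key : (1 + u * c) * (1 + s * (1 + u * c)) =
      (1 + u * c) + s * (1 + u * c) + u * s * x := by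
    calc _ = (1 + u * c) + s * (1 + u * c) + u * (c * s) * (1 + u * c) := by noncomm_ring
      _ = _ := by rw [← hc, hx]; noncomm_ring
  calc _ = s * (1 + u * c) + s * s * (1 + u * c) + s * u * s * x := by rw [key]; noncomm_ring
    _ = s * (1 + u * c) + (1 + u * c) + u * s * (u * x) := by rw [hs, hb]; noncomm_ring
    _ = _ := by rw [hu, key]; abel

theorem comm_mul_mul_one_add_eq_zero {A : Type*} [Ring A] {p s b : A} (hp : p * b = b * p)
    (h : s * (b * (1 + s * b)) = b * (1 + s * b)) :
    (p * s * b - b * (p * s)) * b * (1 + s * b) = 0 := by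
  set x := b * (1 + s * b) with hx
  have hbx : b * x = x * (s * b) := by
    conv_lhs => rw [← h]
    rw [hx]
    noncomm_ring
  have hsbx : s * b * x = x * (s * b) := by
    rw [mul_assoc, hbx, ← mul_assoc, h]
  calc _ = p * (s * b * x) - b * p * (s * x) := by rw [hx]; noncomm_ring
    _ = 0 := by rw [h, ← hp, mul_assoc p b, hbx, hsbx, sub_self]

section

variable (R : Type*) [CommRing R]

local notation "ι" => MonoidAlgebra.of R (Equiv.Perm (Fin _))

theorem of_simpleTransposition_mul_self (n i : ℕ) :
    ι (simpleTransposition n i) * ι (simpleTransposition n i) = 1 := by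
  rw [← map_mul, simpleTransposition_mul_self, map_one]

theorem commute_of_cyc_t (n : ℕ) {u v w : ℕ} (h : v < w) :
    Commute (ι (cyc n u v)) (t R n w) :=
  Commute.sum_right _ _ _ fun _ _ => (commute_cyc n h).map (ι)

theorem t_eq_sum_add (n : ℕ) {i j : ℕ} (hij : i ≤ j) (hj : j ≤ n + 1) :
    t R n i = ∑ w ∈ Finset.Ico i j, ι (cyc n i w) + ι (cyc n i j) * t R n j := by
  unfold t
  simp only [← Finset.Ico_add_one_right_eq_Icc]
  rw [← Finset.sum_Ico_consecutive _ hij hj, Finset.mul_sum]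
  congr 1
  refine Finset.sum_congr rfl fun w hw => ?_
  rw [← map_mul, cyc_mul_cyc n hij (Finset.mem_Ico.mp hw).1]

theorem t_eq_one_add (n : ℕ) {i : ℕ} (hi : i ≤ n) :
    t R n i = 1 + ι (simpleTransposition n i) * t R n (i + 1) := by
  rw [t_eq_sum_add R n (Nat.le_succ i) (Nat.succ_le_succ hi)]
  simp [cyc_self, cyc_succ, MonoidAlgebra.one_def]

theorem t_self (n : ℕ) : t R n n = 1 := by
  simp [t, cyc_self, MonoidAlgebra.one_def]

theorem comm_t_t (n : ℕ) {i j : ℕ} (hij : i ≤ j) (hj : j ≤ n) :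
    t R n i * t R n j - t R n j * t R n i =
      (ι (cyc n i j) * t R n j - t R n j * ι (cyc n i j)) * t R n j := by
  have hcomm : Commute (∑ w ∈ Finset.Ico i j, ι (cyc n i w)) (t R n j) :=
    Commute.sum_left _ _ _ fun w hw => commute_of_cyc_t R n (Finset.mem_Ico.mp hw).2
  rw [t_eq_sum_add R n hij (by omega), add_mul, mul_add, hcomm.eq]
  noncomm_ring

theorem simpleTransposition_mul_t_succ_mul_t (n : ℕ) {j : ℕ} (hj : 1 ≤ j) (hjn : j < n) :
    ι (simpleTransposition n j) * (t R n (j + 1) * t R n j) = t R n (j + 1) * t R n j := by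
  induction hd : n - j generalizing j with
  | zero => omega
  | succ d ih =>
    rw [t_eq_one_add R n hjn.le]
    rcases Nat.lt_or_ge (j + 1) n with hlt | hge
    · have hu := ih (by omega) hlt (by omega)
      rw [t_eq_one_add R n hlt.le] at hu ⊢
      refine mul_one_add_mul_eq_of_braid (of_simpleTransposition_mul_self R n j) ?_ ?_ hu
      · simp only [← map_mul, simpleTransposition_braid n hj hlt]
      · simpa [cyc_succ] using (commute_of_cyc_t R n (show j + 1 < j + 1 + 1 by omega) :
          Commute (ι (cyc n j (j + 1))) _).eq
    · obtain rfl : j + 1 = n := by omega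
      rw [t_self, one_mul, mul_one, mul_add, mul_one, of_simpleTransposition_mul_self,
        add_comm (1 : MonoidAlgebra R _)]

end

theorem comm_ti_tj_mul_tj_sub_one_eq_zero
    (R : Type*) [CommRing R] (n : ℕ) (hn : 0 < n)
    (i j : ℕ) (hi1 : 1 ≤ i) (hin : i ≤ n) (hj2 : 2 ≤ j) (hjn : j ≤ n)
    (hij : i ≤ j) :
    (t R n i * t R n j - t R n j * t R n i) * t R n (j - 1) = 0 := by
  obtain rfl | hlt := hij.eq_or_lt
  · simp
  obtain ⟨j, rfl⟩ : ∃ l, j = l + 1 := ⟨j - 1, by omega⟩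
  have hc : MonoidAlgebra.of R _ (cyc n i (j + 1)) =
      MonoidAlgebra.of R _ (cyc n i j) * MonoidAlgebra.of R _ (simpleTransposition n j) := by
    rw [← map_mul, ← cyc_succ, cyc_mul_cyc n (by omega) (Nat.le_succ j)]
  have hp := (commute_of_cyc_t R n (Nat.lt_succ_self j) :
    Commute (MonoidAlgebra.of R _ (cyc n i j)) _).eq
  have hs := simpleTransposition_mul_t_succ_mul_t R n (by omega : 1 ≤ j) hjn
  rw [comm_t_t R n hij hjn, hc, Nat.add_sub_cancel]
  rw [t_eq_one_add R n (by omega : j ≤ n)] at hs ⊢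
  exact comm_mul_mul_one_add_eq_zero hp hs
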